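/- arXiv:1109.3902 — 9 statements merged into one kernel-verified Lean document; each statement's English description precedes it below -/
import Mathlib

section
/- For every sequence of colorings (c_n), where each c_n assigns to every pair x < y of natural numbers a color c_n(x,y) ∈ {0,1}, there exists a strictly increasing sequence h_0 < h_1 < h_2 < ⋯ of natural numbers such that for every n, the coloring c_n is monochromatic on all pairs from the tail {h_n, h_{n+1}, h_{n+2}, …}; that is, for all i, j, k, l with n ≤ i < j and n ≤ k < l, c_n(h_i, h_j) = c_n(h_k, h_l). -/
/-- A function into a finite type is eventually constant along an ultrafilter. -/
lemma Ultrafilter.exists_eventually_eq {α β : Type*} [Finite β] (U : Ultrafilter α) (f : α → β) :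
    ∃ b, ∀ᶠ x in U, f x = b :=
  Ultrafilter.eventually_exists_iff.1 (Filter.Eventually.of_forall fun x => ⟨f x, rfl⟩)

/-- Strong simultaneous Ramsey theorem for pairs: given a sequence of 2-colorings
of pairs, there is a single increasing sequence whose `n`-th tail is monochromatic
for the `n`-th coloring. -/
theorem strong_ramsey_pairs
    (c : ℕ → ℕ → ℕ → Fin 2) :
    ∃ h : ℕ → ℕ, StrictMono h ∧
      ∀ n i j k l : ℕ, n ≤ i → i < j → n ≤ k → k < l →
        c n (h i) (h j) = c n (h k) (h l) := by
  let U := Filter.hyperfilter ℕ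
  choose d hd using fun n x => U.exists_eventually_eq (c n x)
  choose e he using fun n => U.exists_eventually_eq (d n)
  -- In a pair `(k, x)`, the vertex `x` is good for the colorings with index at most `k`.
  obtain ⟨f, -, hf⟩ := exists_seq_of_forall_finset_exists
    (fun p : ℕ × ℕ => ∀ n ≤ p.1, d n p.2 = e n)
    (fun p q => p.1 < q.1 ∧ p.2 < q.2 ∧ ∀ n ≤ p.1, c n p.2 q.2 = e n) (by
      intro s hs
      have good : ∀ᶠ x in U, ∀ n ∈ Set.Iic (s.sup Prod.fst + 1), d n x = e n :=
        (Filter.eventually_all_finite (Set.finite_Iic _)).2 fun n _ => he n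
      have later : ∀ᶠ x in U, ∀ p ∈ s, p.2 < x ∧ ∀ n ∈ Set.Iic p.1, c n p.2 x = e n := by
        refine (Filter.eventually_all_finset s).2 fun p hp => ?_
        refine ((Filter.eventually_gt_atTop p.2).filter_mono Nat.hyperfilter_le_atTop).and ?_
        refine (Filter.eventually_all_finite (Set.finite_Iic _)).2 fun n hn => ?_
        rw [← hs p hp n hn]
        exact hd n p.2
      obtain ⟨x, hx, hx'⟩ := (good.and later).exists
      exact ⟨(s.sup Prod.fst + 1, x), hx, fun p hp =>
        ⟨Nat.lt_succ_of_le (Finset.le_sup (f := Prod.fst) hp), hx' p hp⟩⟩)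
  have le_fst : ∀ i, i ≤ (f i).1 := fun _ =>
    StrictMono.le_apply (f := fun i => (f i).1) fun i j hij => (hf i j hij).1
  refine ⟨fun i => (f i).2, fun i j hij => (hf i j hij).2.1, fun n i j k l hi hij hk hkl => ?_⟩
  rw [(hf i j hij).2.2 n (hi.trans (le_fst i)), (hf k l hkl).2.2 n (hk.trans (le_fst k))]
end

section
/- Let U : ℕ → Set ℕ be a condition and let X : ℕ → Set ℕ be any sequence of subsets of ℕ. Then there exists a condition V : ℕ → Set ℕ such that (i) for every n there is an m with V m ⊆ U n, and (ii) for every i there is an m such that either V m ⊆ X i or V m ⊆ ℕ \ X i. -/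
/-- `U` is a condition: every finite intersection of the sets `U n` is infinite. -/
def IsCondition (U : ℕ → Set ℕ) : Prop :=
  ∀ F : Finset ℕ, (⋂ n ∈ F, U n).Infinite

open Filter in
/-- The sets of a condition all belong to a common nonprincipal ultrafilter. -/
theorem IsCondition.exists_ultrafilter {U : ℕ → Set ℕ} (hU : IsCondition U) :
    ∃ g : Ultrafilter ℕ, (g : Filter ℕ) ≤ cofinite ∧ ∀ n, U n ∈ g := by
  let f : Finset ℕ → Filter ℕ := fun F => cofinite ⊓ 𝓟 (⋂ n ∈ F, U n)
  have hf : Antitone f := fun F G hFG =>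
    inf_le_inf_left _ (principal_mono.2 (Set.biInter_subset_biInter_left hFG))
  have hne : (⨅ F, f F).NeBot :=
    iInf_neBot_of_directed' hf.directed_ge fun F => (hU F).cofinite_inf_principal_neBot
  obtain ⟨g, hg⟩ := Ultrafilter.exists_le (⨅ F, f F)
  refine ⟨g, hg.trans ((iInf_le f ∅).trans inf_le_left), fun n => ?_⟩
  have h : (g : Filter ℕ) ≤ 𝓟 (⋂ k ∈ ({n} : Finset ℕ), U k) :=
    hg.trans ((iInf_le f {n}).trans inf_le_right)
  simpa using h

open Filter in
/-- Countably many members of a nonprincipal ultrafilter form a condition. -/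
theorem IsCondition.of_mem_ultrafilter {V : ℕ → Set ℕ} {g : Ultrafilter ℕ}
    (hg : (g : Filter ℕ) ≤ cofinite) (hV : ∀ n, V n ∈ g) : IsCondition V := by
  intro F hfin
  have hmem : (⋂ n ∈ F, V n) ∈ g := (biInter_finset_mem F).2 fun n _ => hV n
  exact Ultrafilter.compl_mem_iff_notMem.1 (hg hfin.compl_mem_cofinite) hmem

/-- Any condition can be extended to a condition deciding each set `X i`. -/
theorem condition_decides (U X : ℕ → Set ℕ) (hU : IsCondition U) :
    ∃ V : ℕ → Set ℕ, IsCondition V ∧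
      (∀ n : ℕ, ∃ m : ℕ, V m ⊆ U n) ∧
      (∀ i : ℕ, ∃ m : ℕ, V m ⊆ X i ∨ V m ⊆ (X i)ᶜ) := by
  obtain ⟨g, hg, hgU⟩ := hU.exists_ultrafilter
  have hX : ∀ i, ∃ Y ∈ g, Y ⊆ X i ∨ Y ⊆ (X i)ᶜ := fun i =>
    (g.mem_or_compl_mem (X i)).elim (fun h => ⟨_, h, .inl subset_rfl⟩)
      fun h => ⟨_, h, .inr subset_rfl⟩
  choose Y hYg hY using hX
  let W : ℕ ⊕ ℕ → Set ℕ := Sum.elim U Y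
  have hW : ∀ s, W s ∈ g := Sum.rec hgU hYg
  let e := Equiv.natSumNatEquivNat
  refine ⟨fun m => W (e.symm m), .of_mem_ultrafilter hg fun m => hW _,
    fun n => ⟨e (.inl n), ?_⟩, fun i => ⟨e (.inr i), ?_⟩⟩
  · simp only [Equiv.symm_apply_apply]
    exact subset_rfl
  · simp only [Equiv.symm_apply_apply]
    exact hY i
end

section
/- Let 𝔓 be a divisible family of subsets of ℕ and let U : ℕ → Set ℕ be a family such that for every finite F ⊆ ℕ, the intersection ⋂_{n ∈ F} U n belongs to 𝔓. Then for any set X ⊆ ℕ, either for every finite F ⊆ ℕ the set (⋂_{n ∈ F} U n) ∩ X belongs to 𝔓, or for every finite F ⊆ ℕ the set (⋂_{n ∈ F} U n) ∩ (ℕ \ X) belongs to 𝔓. -/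
/-- A family of subsets of ℕ is divisible. -/
def Divisible (P : Set (Set ℕ)) : Prop :=
  Set.univ ∈ P ∧ ∅ ∉ P ∧
    (∀ S ∈ P, ∀ T : Set ℕ, S ⊆ T → T ∈ P) ∧
    (∀ S ∈ P, ∀ S₀ S₁ : Set ℕ, S = S₀ ∪ S₁ → S₀ ∈ P ∨ S₁ ∈ P)

/-- A filter base all of whose finite intersections are in a divisible family
can be extended by `X` or by its complement, keeping all finite intersections
in the family. -/
theorem divisible_extend (P : Set (Set ℕ)) (hP : Divisible P)
    (U : ℕ → Set ℕ) (hU : ∀ F : Finset ℕ, (⋂ n ∈ F, U n) ∈ P)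
    (X : Set ℕ) :
    (∀ F : Finset ℕ, (⋂ n ∈ F, U n) ∩ X ∈ P) ∨
    (∀ F : Finset ℕ, (⋂ n ∈ F, U n) ∩ Xᶜ ∈ P) := by
  obtain ⟨-, -, hmono, hdiv⟩ := hP
  by_contra! h
  obtain ⟨⟨F, hF⟩, G, hG⟩ := h
  rcases hdiv _ (hU (F ∪ G)) _ _ (Set.inter_union_compl _ X).symm with h | h
  · exact hF (hmono _ h _ (Set.inter_subset_inter_left _
      (Set.biInter_subset_biInter_left fun _ hn => Finset.mem_union_left G hn)))
  · exact hG (hmono _ h _ (Set.inter_subset_inter_left _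
      (Set.biInter_subset_biInter_left fun _ hn => Finset.mem_union_right F hn)))
end

section
/- Let 𝔓 be a divisible family of subsets of ℕ, let U : ℕ → Set ℕ be a family such that every finite intersection ⋂_{n ∈ F} U n (F ⊆ ℕ finite) belongs to 𝔓, and let X : ℕ → Set ℕ be any sequence of subsets of ℕ. Then there exists ε : ℕ → {0,1} such that for all finite sets F, G ⊆ ℕ, the set (⋂_{n ∈ F} U n) ∩ (⋂_{i ∈ G} X_i^{ε(i)}) belongs to 𝔓, where X_i^{1} = X i and X_i^{0} = ℕ \ X i. -/
/-- The filter of sets whose complement meets some finite intersection of the `U n` in a set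
outside `P`. -/
def Divisible.coFilter {P : Set (Set ℕ)} (hP : Divisible P) (U : ℕ → Set ℕ) : Filter ℕ where
  sets := {S | ∃ F : Finset ℕ, (⋂ n ∈ F, U n) ∩ Sᶜ ∉ P}
  univ_sets := ⟨∅, by simpa using hP.2.1⟩
  sets_of_superset := by
    rintro S T ⟨F, hF⟩ hST
    exact ⟨F, fun h => hF (hP.2.2.1 _ h _
      (Set.inter_subset_inter_right _ (Set.compl_subset_compl.2 hST)))⟩
  inter_sets := by
    rintro S T ⟨F, hF⟩ ⟨G, hG⟩
    refine ⟨F ∪ G, fun h => ?_⟩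
    rw [Set.compl_inter, Set.inter_union_distrib_left] at h
    rcases hP.2.2.2 _ h _ _ rfl with h | h
    · exact hF (hP.2.2.1 _ h _ (Set.inter_subset_inter_left _
        (Set.biInter_subset_biInter_left fun _ => Finset.mem_union_left G)))
    · exact hG (hP.2.2.1 _ h _ (Set.inter_subset_inter_left _
        (Set.biInter_subset_biInter_left fun _ => Finset.mem_union_right F)))

/-- A sequence with all finite intersections in a divisible family lies in an ultrafilter
contained in that family. -/
theorem Divisible.exists_ultrafilter {P : Set (Set ℕ)} (hP : Divisible P)
    (U : ℕ → Set ℕ) (hU : ∀ F : Finset ℕ, (⋂ n ∈ F, U n) ∈ P) :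
    ∃ 𝒰 : Ultrafilter ℕ, (∀ n, U n ∈ 𝒰) ∧ ∀ S ∈ 𝒰, S ∈ P := by
  have hne : (hP.coFilter U).NeBot := by
    refine ⟨fun h => ?_⟩
    obtain ⟨F, hF⟩ : ∅ ∈ hP.coFilter U := Filter.empty_mem_iff_bot.2 h
    exact hF (by simpa using hU F)
  refine ⟨Ultrafilter.of (hP.coFilter U), fun n => ?_, fun S hS => ?_⟩
  · exact Ultrafilter.of_le _ ⟨{n}, by simpa using hP.2.1⟩
  · by_contra hSP
    have hc : Sᶜ ∈ Ultrafilter.of (hP.coFilter U) :=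
      Ultrafilter.of_le _ ⟨∅, by simpa using hSP⟩
    exact Ultrafilter.compl_mem_iff_notMem.1 hc hS

/-- A filter base with finite intersections in a divisible family can be
extended to decide each member of a given sequence of sets, keeping all
finite intersections in the family. -/
theorem divisible_extend_seq (P : Set (Set ℕ)) (hP : Divisible P)
    (U : ℕ → Set ℕ) (hU : ∀ F : Finset ℕ, (⋂ n ∈ F, U n) ∈ P)
    (X : ℕ → Set ℕ) :
    ∃ ε : ℕ → Fin 2, ∀ F G : Finset ℕ,
      (⋂ n ∈ F, U n) ∩ (⋂ i ∈ G, if ε i = 1 then X i else (X i)ᶜ) ∈ P := by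
  classical
  obtain ⟨𝒰, hU𝒰, h𝒰P⟩ := hP.exists_ultrafilter U hU
  refine ⟨fun i => if X i ∈ 𝒰 then 1 else 0, fun F G => h𝒰P _ (Filter.inter_mem ?_ ?_)⟩
  · exact (Filter.biInter_finset_mem F).2 fun n _ => hU𝒰 n
  · refine (Filter.biInter_finset_mem G).2 fun i _ => ?_
    by_cases h : X i ∈ 𝒰
    · simp [h]
    · simpa [h] using Ultrafilter.compl_mem_iff_notMem.2 h
end

section
/- Let 𝔓 be a divisible family of subsets of ℕ such that every element of 𝔓 is infinite. Then there exists a non-principal ultrafilter 𝔘 on ℕ such that every element of 𝔘 belongs to 𝔓. -/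
/-- For a divisible family all of whose members are infinite there is a
non-principal ultrafilter contained in the family. -/
theorem exists_ultrafilter_in_divisible (P : Set (Set ℕ))
    (hP : Divisible P) (hInf : ∀ S ∈ P, S.Infinite) :
    ∃ 𝔘 : Ultrafilter ℕ, (∀ S ∈ 𝔘, S.Infinite) ∧ (∀ S ∈ 𝔘, S ∈ P) := by
  obtain ⟨huniv, hempty, hmono, hunion⟩ := hP
  -- The dual filter: sets whose complement is not in `P`.
  let F : Filter ℕ := Filter.comk (· ∉ P) hempty
    (fun t ht s hst hs => ht (hmono s hs t hst))
    (fun s hs t ht hst => (hunion _ hst s t rfl).elim hs ht)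
  have hF : F.NeBot := by
    rw [Filter.neBot_iff, ne_eq, ← Filter.empty_mem_iff_bot]
    simpa [F] using huniv
  obtain ⟨u, hu⟩ := Ultrafilter.exists_le F
  have key : ∀ S ∈ u, S ∈ P := by
    intro S hS
    by_contra hSP
    have hSc : Sᶜ ∈ F := by simpa [F] using hSP
    exact Ultrafilter.compl_mem_iff_notMem.1 (hu hSc) hS
  exact ⟨u, fun S hS => hInf S (key S hS), key⟩
end

section
/- If S ⊆ ℕ is piecewise syndetic and S = S₀ ∪ S₁, then S₀ is piecewise syndetic or S₁ is piecewise syndetic. -/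
/-- `S` is piecewise syndetic. -/
def PiecewiseSyndetic (S : Set ℕ) : Prop :=
  ∃ b : ℕ, ∀ n : ℕ, ∃ x : ℕ, ∀ i ∈ Set.Icc x (x + n),
    ∃ j ∈ Set.Icc i (i + b), j ∈ S

/-- Piecewise syndeticity is a divisible property. -/
theorem piecewiseSyndetic_divisible (S S₀ S₁ : Set ℕ)
    (hS : PiecewiseSyndetic S) (hunion : S = S₀ ∪ S₁) :
    PiecewiseSyndetic S₀ ∨ PiecewiseSyndetic S₁ := by
  obtain ⟨b, hb⟩ := hS
  refine or_iff_not_imp_left.mpr fun h₀ => ⟨b, fun n => ?_⟩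
  unfold PiecewiseSyndetic at h₀
  push Not at h₀
  obtain ⟨m, hm⟩ := h₀ (n + b)
  obtain ⟨x, hx⟩ := hb (m + n)
  obtain ⟨i, ⟨hxi, him⟩, hi⟩ := hm x
  refine ⟨i, fun k ⟨hik, hkn⟩ => ?_⟩
  obtain ⟨j, ⟨hkj, hjb⟩, hj⟩ := hx k ⟨by omega, by omega⟩
  rw [hunion] at hj
  exact ⟨j, ⟨hkj, hjb⟩, hj.resolve_left (hi j ⟨by omega, by omega⟩)⟩
end

section
/- There exists a non-principal ultrafilter 𝔘 on ℕ such that every element of 𝔘 is piecewise syndetic. -/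
theorem PiecewiseSyndetic.mono {S T : Set ℕ} (hS : PiecewiseSyndetic S) (hST : S ⊆ T) :
    PiecewiseSyndetic T := by
  obtain ⟨b, hb⟩ := hS
  refine ⟨b, fun n => ?_⟩
  obtain ⟨x, hx⟩ := hb n
  exact ⟨x, fun i hi => (hx i hi).imp fun _ hj => ⟨hj.1, hST hj.2⟩⟩

theorem not_piecewiseSyndetic_empty : ¬ PiecewiseSyndetic ∅ := by
  rintro ⟨b, hb⟩
  obtain ⟨x, hx⟩ := hb 0
  obtain ⟨_, _, hj⟩ := hx x (by simp)
  exact hj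

theorem piecewiseSyndetic_univ : PiecewiseSyndetic Set.univ :=
  ⟨0, fun _ => ⟨0, fun i _ => ⟨i, by simp⟩⟩⟩

theorem PiecewiseSyndetic.infinite {S : Set ℕ} (hS : PiecewiseSyndetic S) : S.Infinite := by
  obtain ⟨b, hb⟩ := hS
  refine Set.infinite_of_forall_exists_gt fun n => ?_
  obtain ⟨x, hx⟩ := hb (n + 1)
  obtain ⟨j, hj, hjS⟩ := hx (x + (n + 1)) (by simp)
  exact ⟨j, hjS, by have := hj.1; omega⟩

/-- Piecewise syndeticity is partition regular. -/
theorem PiecewiseSyndetic.of_union {A B : Set ℕ} (h : PiecewiseSyndetic (A ∪ B)) :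
    PiecewiseSyndetic A ∨ PiecewiseSyndetic B := by
  by_contra! ⟨hA, hB⟩
  apply hB
  obtain ⟨b, hb⟩ := h
  simp only [PiecewiseSyndetic] at hA
  push Not at hA
  refine ⟨b, fun m => ?_⟩
  obtain ⟨n, hn⟩ := hA (m + b)
  obtain ⟨x, hx⟩ := hb (n + m)
  obtain ⟨i, hi, hiA⟩ := hn x
  simp only [Set.mem_Icc] at hx hi hiA
  refine ⟨i, fun k ⟨hik, hki⟩ => ?_⟩
  obtain ⟨j, hj, hjS⟩ := hx k (by omega)
  exact ⟨j, hj, hjS.resolve_left (hiA j (by omega))⟩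

/-- The filter of sets whose complement is not piecewise syndetic. -/
def piecewiseSyndeticDual : Filter ℕ :=
  Filter.comk (fun S => ¬ PiecewiseSyndetic S) not_piecewiseSyndetic_empty
    (fun _ hT _ hST hS => hT (hS.mono hST))
    (fun _ hS _ hT h => h.of_union.elim hS hT)

instance : piecewiseSyndeticDual.NeBot := by
  refine ⟨fun h => ?_⟩
  have h' : ∅ ∈ piecewiseSyndeticDual := Filter.empty_mem_iff_bot.mpr h
  rw [piecewiseSyndeticDual, Filter.mem_comk, Set.compl_empty] at h'
  exact h' piecewiseSyndetic_univ

/-- There is a non-principal ultrafilter all of whose members are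
piecewise syndetic. -/
theorem exists_piecewiseSyndetic_ultrafilter :
    ∃ 𝔘 : Ultrafilter ℕ, (∀ S ∈ 𝔘, S.Infinite) ∧
      (∀ S ∈ 𝔘, PiecewiseSyndetic S) := by
  have key : ∀ S ∈ Ultrafilter.of piecewiseSyndeticDual, PiecewiseSyndetic S := by
    intro S hS
    by_contra hPS
    have hc : Sᶜ ∈ piecewiseSyndeticDual := by
      rwa [piecewiseSyndeticDual, Filter.mem_comk, compl_compl]
    exact Ultrafilter.compl_mem_iff_notMem.mp (Ultrafilter.of_le piecewiseSyndeticDual hc) hS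
  exact ⟨_, fun S hS => (key S hS).infinite, key⟩
end

section
/- Let 𝔘 be an idempotent ultrafilter on (ℕ, +) all of whose elements are infinite. Then every element S of 𝔘 is an IP set: there is a strictly increasing sequence s₀ < s₁ < s₂ < ⋯ of natural numbers such that every sum of finitely many distinct terms of the sequence belongs to S. -/
/-- If `A (i + 1) ⊆ A i ∩ (A i - s i)` and `s i ∈ A i` for all `i`, then nonempty finite sums of
distinct terms of `s` with indices at least `j` lie in `A j`. -/
theorem Finset.sum_mem_of_translate_chain {M : Type*} [AddCommMonoid M] {A : ℕ → Set M} {s : ℕ → M}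
    (hs : ∀ i, s i ∈ A i) (hsub : ∀ i, A (i + 1) ⊆ A i)
    (hadd : ∀ i, ∀ m ∈ A (i + 1), m + s i ∈ A i) (F : Finset ℕ) :
    F.Nonempty → ∀ j, (∀ i ∈ F, j ≤ i) → ∑ i ∈ F, s i ∈ A j := by
  have hanti : Antitone A := antitone_nat_of_succ_le hsub
  induction F using Finset.induction_on_min with
  | empty => simp
  | insert a F ha ih =>
    intro _ j hj
    have haF : a ∉ F := fun h => (ha a h).false
    refine hanti (hj a (Finset.mem_insert_self a F)) ?_
    rw [Finset.sum_insert haF, add_comm]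
    obtain rfl | hF := F.eq_empty_or_nonempty
    · simpa using hs a
    · exact hadd a _ (ih hF (a + 1) ha)

/-- Every member of a non-principal idempotent ultrafilter on `(ℕ, +)` is an
IP set. -/
theorem idempotent_ultrafilter_mem_IP (𝔘 : Ultrafilter ℕ)
    (hnp : ∀ S ∈ 𝔘, S.Infinite)
    (hidem : ∀ S ∈ 𝔘, {n : ℕ | {m : ℕ | m + n ∈ S} ∈ 𝔘} ∈ 𝔘) :
    ∀ S ∈ 𝔘, ∃ s : ℕ → ℕ, StrictMono s ∧
      ∀ F : Finset ℕ, F.Nonempty → (∑ i ∈ F, s i) ∈ S := by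
  intro S hS
  have hstep : ∀ (A : {A : Set ℕ // A ∈ 𝔘}) (k : ℕ),
      ∃ n, n ∈ A.1 ∧ {m : ℕ | m + n ∈ A.1} ∈ 𝔘 ∧ k < n := by
    rintro ⟨A, hA⟩ k
    obtain ⟨n, ⟨hnA, hn⟩, hkn⟩ := (hnp _ (Filter.inter_mem hA (hidem A hA))).exists_gt k
    exact ⟨n, hnA, hn, hkn⟩
  choose f hfmem hftrans hflt using hstep
  let state : ℕ → {A : Set ℕ // A ∈ 𝔘} × ℕ := fun i =>
    Nat.rec (⟨S, hS⟩, 0)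
      (fun _ p => (⟨_, Filter.inter_mem p.1.2 (hftrans p.1 p.2)⟩, f p.1 p.2)) i
  refine ⟨fun i => f (state i).1 (state i).2, strictMono_nat_of_lt_succ fun i => hflt _ _,
    fun F hF => ?_⟩
  exact Finset.sum_mem_of_translate_chain (A := fun i => (state i).1.1)
    (fun i => hfmem _ _) (fun i => Set.inter_subset_left) (fun i m hm => hm.2) F hF 0
    fun i _ => i.zero_le
end

section
/- (Single-instance P-point extension.) Let U : ℕ → Set ℕ be a condition and let (S_n) be a sequence of pairwise disjoint subsets of ℕ with ℕ = ⋃_n S_n. Then either there is an n such that the family U together with S_n is still a condition (i.e., every finite intersection of sets from U intersected with S_n is infinite), or there exists an infinite set A ⊆ ℕ such that the family U together with A is a condition and A ∩ S_n is finite for every n. -/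
/-- An antitone sequence of infinite sets has a pseudo-intersection that meets each set of the
sequence in an infinite set, and every set almost disjoint from some `V n` in a finite one. -/
theorem exists_pseudointersection {V : ℕ → Set ℕ} (hV : Antitone V)
    (hinf : ∀ k, (V k).Infinite) :
    ∃ A : Set ℕ, (∀ k, (V k ∩ A).Infinite) ∧
      ∀ T : Set ℕ, (∃ n, (V n ∩ T).Finite) → (A ∩ T).Finite := by
  choose x hxV hx using fun k => (hinf k).exists_gt k
  refine ⟨Set.range x, fun k => ?_, ?_⟩
  · refine Set.infinite_of_forall_exists_gt fun a => ⟨x (max k a), ⟨?_, Set.mem_range_self _⟩, ?_⟩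
    · exact hV (le_max_left k a) (hxV _)
    · exact (le_max_right k a).trans_lt (hx _)
  · rintro T ⟨n, hn⟩
    refine (((Set.finite_Iio n).image x).union hn).subset ?_
    rintro _ ⟨⟨k, rfl⟩, hk⟩
    rcases lt_or_ge k n with h | h
    · exact Or.inl ⟨k, h, rfl⟩
    · exact Or.inr ⟨hV h (hxV k), hk⟩

/-- Single-instance P-point extension: a condition can be extended so as to
handle a single partition of ℕ in the P-point manner. -/
theorem ppoint_single_instance (U : ℕ → Set ℕ) (hU : IsCondition U)
    (S : ℕ → Set ℕ) (hdisj : Pairwise (Function.onFun Disjoint S))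
    (hcover : (⋃ n, S n) = Set.univ) :
    (∃ n : ℕ, ∀ F : Finset ℕ, ((⋂ m ∈ F, U m) ∩ S n).Infinite) ∨
    (∃ A : Set ℕ, A.Infinite ∧
      (∀ F : Finset ℕ, ((⋂ m ∈ F, U m) ∩ A).Infinite) ∧
      (∀ n : ℕ, (A ∩ S n).Finite)) := by
  refine or_iff_not_imp_left.mpr fun h => ?_
  simp only [not_exists, not_forall, Set.not_infinite] at h
  choose F hF using h
  have hanti : Antitone fun k => ⋂ m ∈ Finset.range k, U m := fun a b hab =>
    Set.biInter_subset_biInter_left fun m hm => Finset.range_mono hab hm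
  have hsub (G : Finset ℕ) : ∃ k, (⋂ m ∈ Finset.range k, U m) ⊆ ⋂ m ∈ G, U m := by
    obtain ⟨k, hk⟩ := G.exists_nat_subset_range
    exact ⟨k, Set.biInter_subset_biInter_left fun m hm => hk hm⟩
  obtain ⟨A, hA, hAT⟩ := exists_pseudointersection hanti fun k => hU _
  refine ⟨A, (hA 0).mono Set.inter_subset_right, fun G => ?_, fun n => hAT _ ?_⟩
  · obtain ⟨k, hk⟩ := hsub G
    exact (hA k).mono (Set.inter_subset_inter_left _ hk)
  · obtain ⟨k, hk⟩ := hsub (F n)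
    exact ⟨k, (hF n).subset (Set.inter_subset_inter_left _ hk)⟩
end
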